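/- Let d and N be positive integers and let R be a commutative ℂ-algebra graded by the lattice ℤ^d, with every graded piece R_α a finite-dimensional ℂ-vector space, generated as a ℂ-algebra by homogeneous elements of weights α_1, …, α_N ∈ ℤ^d. Then for every fixed real t > 0, the function ξ ↦ F(ξ, t) = Σ_{α ∈ ℤ^d} (dim_ℂ R_α) e^{−t⟨α, ξ⟩} is continuous on the open convex cone C_R = {ξ ∈ ℝ^d : ⟨α_i, ξ⟩ > 0 for all i = 1, …, N}. -/

import Mathlib

/-- A product of summable nonnegative functions, each in its own variable, is summable. -/
theorem summable_fin_prod_of_nonneg {n : ℕ} {κ : Type*} (f : Fin n → κ → ℝ)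
    (hf : ∀ i, Summable (f i)) (hf0 : ∀ i k, 0 ≤ f i k) :
    Summable fun m : Fin n → κ => ∏ i, f i (m i) := by
  induction n with
  | zero => exact Summable.of_finite
  | succ n ih =>
    rw [← (Fin.consEquiv fun _ => κ).summable_iff]
    have h := (hf 0).mul_of_nonneg (ih (fun i => f i.succ) (fun i => hf _) fun i => hf0 _)
      (hf0 0) fun m => Finset.prod_nonneg fun i _ => hf0 _ _
    simpa [Function.comp_def, Fin.prod_univ_succ, Fin.consEquiv] using h

theorem summable_exp_neg_sum_mul {n : ℕ} {c : Fin n → ℝ} (hc : ∀ i, 0 < c i) :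
    Summable fun m : Fin n → ℕ => Real.exp (-∑ i, (m i : ℝ) * c i) := by
  have h := summable_fin_prod_of_nonneg (fun i (k : ℕ) => Real.exp (k * -c i))
    (fun i => Real.summable_exp_nat_mul_iff.2 (neg_neg_of_pos (hc i)))
    fun i k => (Real.exp_pos _).le
  simpa [← Real.exp_sum, Finset.sum_neg_distrib] using h

section GradedAlgebra

variable {K ι R σ : Type*} [Field K] [DecidableEq ι] [AddCommMonoid ι] [CommRing R] [Algebra K R]
  [Fintype σ] (𝒜 : ι → Submodule K R) [GradedAlgebra 𝒜] {x : σ → R} {α : σ → ι}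

/-- If homogeneous elements `x i` generate a graded algebra, each graded piece is spanned by the
monomials in the `x i` of the corresponding weight. -/
theorem graded_piece_le_span_monomials (hx : ∀ i, x i ∈ 𝒜 (α i))
    (hgen : Algebra.adjoin K (Set.range x) = ⊤) (a : ι) :
    𝒜 a ≤ Submodule.span K
      (Set.range fun m : {m : σ → ℕ // ∑ i, m i • α i = a} => ∏ i, x i ^ m.1 i) := by
  intro y hy
  have hy' : y ∈ (MvPolynomial.aeval x : MvPolynomial σ K →ₐ[K] R).range := by
    rw [← Algebra.adjoin_range_eq_range_aeval, hgen]
    trivial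
  obtain ⟨p, rfl⟩ := hy'
  have hproj := DirectSum.decompose_of_mem_same 𝒜 hy
  rw [← GradedAlgebra.proj_apply] at hproj
  rw [← hproj]
  change GradedAlgebra.proj 𝒜 a (MvPolynomial.aeval x p) ∈ _
  rw [MvPolynomial.aeval_def, MvPolynomial.eval₂_eq', map_sum]
  refine Submodule.sum_mem _ fun m _ => ?_
  rw [← Algebra.smul_def, map_smul, GradedAlgebra.proj_apply]
  refine Submodule.smul_mem _ _ ?_
  have hm : ∏ i, x i ^ m i ∈ 𝒜 (∑ i, m i • α i) :=
    SetLike.prod_pow_mem_graded 𝒜 α x m fun i _ => hx i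
  by_cases h : ∑ i, m i • α i = a
  · rw [DirectSum.decompose_of_mem_same 𝒜 (h ▸ hm)]
    exact Submodule.subset_span ⟨⟨m, h⟩, rfl⟩
  · rw [DirectSum.decompose_of_mem_ne 𝒜 hm h]
    exact Submodule.zero_mem _

/-- The dimension of a graded piece is at most the number of monomials of that weight. -/
theorem finrank_graded_piece_le_card (hx : ∀ i, x i ∈ 𝒜 (α i))
    (hgen : Algebra.adjoin K (Set.range x) = ⊤) (a : ι)
    [Fintype {m : σ → ℕ // ∑ i, m i • α i = a}] :
    Module.finrank K (𝒜 a) ≤ Fintype.card {m : σ → ℕ // ∑ i, m i • α i = a} := by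
  have : FiniteDimensional K (Submodule.span K
      (Set.range fun m : {m : σ → ℕ // ∑ i, m i • α i = a} => ∏ i, x i ^ m.1 i)) :=
    FiniteDimensional.span_of_finite K (Set.finite_range _)
  exact (Submodule.finrank_mono (graded_piece_le_span_monomials 𝒜 hx hgen a)).trans
    (finrank_range_le_card _)

end GradedAlgebra

/-- A weight pairs with a vector as the sum of the pairings of its constituents. -/
theorem sum_nsmul_pairing {d N : ℕ} (α : Fin N → Fin d → ℤ) (m : Fin N → ℕ) (ξ : Fin d → ℝ) :
    ∑ j, (((∑ i, m i • α i) j : ℤ) : ℝ) * ξ j = ∑ i, (m i : ℝ) * ∑ j, (α i j : ℝ) * ξ j := by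
  simp only [Finset.sum_apply, Pi.smul_apply]
  simp only [nsmul_eq_mul, Int.cast_sum, Int.cast_mul, Int.cast_natCast, Finset.sum_mul,
    Finset.mul_sum, mul_assoc]
  exact Finset.sum_comm


/-- Let `R` be a commutative `ℂ`-algebra graded by `ℤ^d` with finite-dimensional
graded pieces, generated as a `ℂ`-algebra by homogeneous elements of weights
`α 1, …, α N ∈ ℤ^d`.  Then for every fixed real `t > 0`, the index character
`ξ ↦ F(ξ, t) = Σ_a (dim_ℂ R_a) e^{−t⟨a, ξ⟩}` is continuous on the open Reeb cone
`C_R = {ξ : ⟨α i, ξ⟩ > 0 for all i}`. -/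
theorem index_character_continuousOn
    {d N : ℕ} (hd : 0 < d) (hN : 0 < N)
    {R : Type*} [CommRing R] [Algebra ℂ R]
    (𝒜 : (Fin d → ℤ) → Submodule ℂ R) [GradedAlgebra 𝒜]
    (hfd : ∀ a : Fin d → ℤ, FiniteDimensional ℂ ↥(𝒜 a))
    (x : Fin N → R) (α : Fin N → (Fin d → ℤ))
    (hx : ∀ i, x i ∈ 𝒜 (α i))
    (hgen : Algebra.adjoin ℂ (Set.range x) = ⊤)
    (t : ℝ) (ht : 0 < t) :
    ContinuousOn
      (fun ξ : Fin d → ℝ => ∑' a : Fin d → ℤ,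
        (Module.finrank ℂ ↥(𝒜 a) : ℝ) * Real.exp (-t * ∑ j, (a j : ℝ) * ξ j))
      {ξ : Fin d → ℝ | ∀ i, 0 < ∑ j, (α i j : ℝ) * ξ j} := by
  have hpair : ∀ a : Fin d → ℤ, Continuous fun ξ : Fin d → ℝ => ∑ j, (a j : ℝ) * ξ j :=
    fun a => by fun_prop
  intro ξ₀ hξ₀
  apply ContinuousAt.continuousWithinAt
  set c : Fin N → ℝ := fun i => (∑ j, (α i j : ℝ) * ξ₀ j) / 2 with hc_def
  have hc : ∀ i, 0 < c i := fun i => half_pos (hξ₀ i)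
  let U : Set (Fin d → ℝ) := {ξ | ∀ i, c i < ∑ j, (α i j : ℝ) * ξ j}
  have hU : IsOpen U := by
    simp only [U, Set.ofPred_forall]
    exact isOpen_iInter_of_finite fun i => isOpen_lt continuous_const (hpair _)
  have hξ₀U : ξ₀ ∈ U := fun i => half_lt_self (hξ₀ i)
  refine ContinuousOn.continuousAt (s := U) ?_ (hU.mem_nhds hξ₀U)
  let w : (Fin N → ℕ) → Fin d → ℤ := fun m => ∑ i, m i • α i
  let g : (Fin N → ℕ) → ℝ := fun m => Real.exp (-∑ i, (m i : ℝ) * (t * c i))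
  have hg : Summable g := summable_exp_neg_sum_mul fun i => mul_pos ht (hc i)
  have hg_fiber : ∀ (a : Fin d → ℤ) (m : {m // w m = a}),
      g m = Real.exp (-(t * ((∑ j, (a j : ℝ) * ξ₀ j) / 2))) := by
    rintro a ⟨m, rfl⟩
    simp only [g, w, sum_nsmul_pairing, hc_def, Finset.sum_div, Finset.mul_sum]
    congr 2
    refine Finset.sum_congr rfl fun i _ => ?_
    refine Finset.sum_congr rfl fun j _ => ?_
    ring
  have hfin : ∀ a : Fin d → ℤ, Finite {m // w m = a} := by
    intro a
    by_contra h
    rw [not_finite_iff_infinite] at h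
    have hs : Summable fun m : {m // w m = a} => g m := hg.subtype _
    simp only [hg_fiber] at hs
    exact (Real.exp_pos _).ne' ((summable_const_iff _).1 hs)
  have hu : Summable fun a : Fin d → ℤ => ∑' m : {m // w m = a}, g m :=
    ((Equiv.sigmaFiberEquiv w).summable_iff.2 hg).sigma
  refine continuousOn_tsum (fun a => ?_) hu fun a ξ hξ => ?_
  · have := hpair a
    fun_prop
  · have := Fintype.ofFinite {m // w m = a}
    rw [Real.norm_of_nonneg (by positivity), tsum_fintype]
    calc (Module.finrank ℂ (𝒜 a) : ℝ) * Real.exp (-t * ∑ j, (a j : ℝ) * ξ j)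
        ≤ (Fintype.card {m // w m = a} : ℝ) * Real.exp (-t * ∑ j, (a j : ℝ) * ξ j) := by
          gcongr
          exact finrank_graded_piece_le_card 𝒜 hx hgen a
      _ = ∑ _m : {m // w m = a}, Real.exp (-t * ∑ j, (a j : ℝ) * ξ j) := by simp
      _ ≤ ∑ m : {m // w m = a}, g m := by
          refine Finset.sum_le_sum ?_
          rintro ⟨m, rfl⟩ _
          simp only [g, w, sum_nsmul_pairing]
          rw [Real.exp_le_exp, neg_mul, neg_le_neg_iff, Finset.mul_sum]
          refine Finset.sum_le_sum fun i _ => ?_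
          rw [mul_left_comm]
          have := (hξ i).le
          gcongr
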